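/- Suppose F ∈ X_γ has exactly m roots in D, labeled α_1,…,α_m (with multiplicity), so F(z) = (∏_{j=1}^m (z−α_j)/(1−ᾱ_j z))·G(z) with G zero-free in D. Define the partial decompositions F_k(z) = (∏_{j=k+1}^m (z−α_j)/(1−ᾱ_j z))·G(z) and H_{α_k}(z) = F_k(z)/(1−ᾱ_k z). Then for any 1 ≤ n ≤ m, ‖F_n‖_{X_γ}^2 = ‖F‖_{X_γ}^2 − Σ_{j=1}^n (1−|α_j|^2)‖H_{α_j}‖_{Y_γ}^2. -/

import Mathlib

open Finset

noncomputable def xnorm2 (γ : ℕ → ℝ) (a : ℕ → ℂ) : ℝ := ∑' n, γ n * ‖a n‖ ^ 2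

noncomputable def ynorm2 (γ : ℕ → ℝ) (a : ℕ → ℂ) : ℝ :=
  ∑' n, (γ (n + 1) - γ n) * ‖a n‖ ^ 2

theorem coef_unique (a b : ℕ → ℂ) (f : ℂ → ℂ)
    (ha : ∀ z : ℂ, ‖z‖ < 1 → HasSum (fun n => a n * z ^ n) (f z))
    (hb : ∀ z : ℂ, ‖z‖ < 1 → HasSum (fun n => b n * z ^ n) (f z)) : a = b := by
  have key : ∀ c : ℕ → ℂ, (∀ z : ℂ, ‖z‖ < 1 → HasSum (fun n => c n * z ^ n) (f z)) →
      HasFPowerSeriesAt f (FormalMultilinearSeries.ofScalars ℂ c) 0 := by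
    intro c hc
    rw [hasFPowerSeriesAt_iff]
    filter_upwards [Metric.ball_mem_nhds (0 : ℂ) one_pos] with z hz
    have hz' : ‖z‖ < 1 := by simpa using hz
    simpa [mul_comm, FormalMultilinearSeries.coeff_ofScalars] using hc z hz'
  have h := (key a ha).eq_formalMultilinearSeries (key b hb)
  funext n
  have := congrArg (fun p => FormalMultilinearSeries.coeff p n) h
  simpa [FormalMultilinearSeries.coeff_ofScalars] using this

theorem shift_hasSum (h : ℕ → ℂ) (u v z s : ℂ) (hs : HasSum (fun n => h n * z ^ n) s) :
    HasSum (fun n => (u * h n + v * (if n = 0 then 0 else h (n - 1))) * z ^ n)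
      ((u + v * z) * s) := by
  have h1 : HasSum (fun n => (if n = 0 then 0 else h (n - 1)) * z ^ n) (z * s) := by
    rw [← hasSum_nat_add_iff' 1]
    simp only [Finset.range_one, Finset.sum_singleton, if_true, zero_mul, sub_zero]
    have e : (fun n => (if n + 1 = 0 then 0 else h (n + 1 - 1)) * z ^ (n + 1))
        = fun n => z * (h n * z ^ n) := by
      funext n
      simp [pow_succ]
      ring
    rw [e]
    exact hs.mul_left z
  have := (hs.mul_left u).add (h1.mul_left v)
  have e : (fun n => (u * h n + v * (if n = 0 then 0 else h (n - 1))) * z ^ n)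
      = fun n => u * (h n * z ^ n) + v * ((if n = 0 then 0 else h (n - 1)) * z ^ n) := by
    funext n; ring
  have e2 : (u + v * z) * s = u * s + v * (z * s) := by ring
  rw [e, e2]
  exact this

theorem conv_step (x y : ℂ) (a : ℂ) (ha : ‖a‖ < 1) :
    ‖x + a * y‖ ^ 2 ≤ ‖x‖ ^ 2 / (1 - ‖a‖) + ‖a‖ * ‖y‖ ^ 2 := by
  have h1 : ‖x + a * y‖ ≤ ‖x‖ + ‖a‖ * ‖y‖ := by
    simpa using norm_add_le x (a * y)
  have h2 : ‖x + a * y‖ ^ 2 ≤ (‖x‖ + ‖a‖ * ‖y‖) ^ 2 := by gcongr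
  refine h2.trans ?_
  have hr : 0 < 1 - ‖a‖ := by linarith
  have h0 := norm_nonneg a
  have : ‖x‖ ^ 2 / (1 - ‖a‖) + ‖a‖ * ‖y‖ ^ 2 - (‖x‖ + ‖a‖ * ‖y‖) ^ 2
      = ‖a‖ * (‖x‖ - (1 - ‖a‖) * ‖y‖) ^ 2 / (1 - ‖a‖) := by
    field_simp
    ring
  have h3 : 0 ≤ ‖a‖ * (‖x‖ - (1 - ‖a‖) * ‖y‖) ^ 2 / (1 - ‖a‖) := by positivity
  linarith

theorem iter_step (h f : ℕ → ℂ) (a : ℂ) (ha : ‖a‖ < 1)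
    (hf : ∀ n, h n = f (n + 1) + a * h (n + 1)) (n J : ℕ) :
    ‖h n‖ ^ 2 ≤ (∑ j ∈ range J, ‖a‖ ^ j * ‖f (n + 1 + j)‖ ^ 2) / (1 - ‖a‖)
      + ‖a‖ ^ J * ‖h (n + J)‖ ^ 2 := by
  induction J with
  | zero => simp
  | succ J ih =>
    refine ih.trans ?_
    have := conv_step (f (n + J + 1)) (h (n + J + 1)) a ha
    rw [← hf (n + J)] at this
    have h2 := mul_le_mul_of_nonneg_left this (pow_nonneg (norm_nonneg a) J)
    rw [Finset.sum_range_succ, add_div]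
    have e : n + 1 + J = n + J + 1 := by ring
    rw [e, ← add_assoc n J 1]
    have e2 : ‖a‖ ^ J * (‖f (n + J + 1)‖ ^ 2 / (1 - ‖a‖) + ‖a‖ * ‖h (n + J + 1)‖ ^ 2)
      = ‖a‖ ^ J * ‖f (n + J + 1)‖ ^ 2 / (1 - ‖a‖) + ‖a‖ ^ (J + 1) * ‖h (n + J + 1)‖ ^ 2 := by ring
    linarith

theorem tail_zero (h : ℕ → ℂ) (a : ℂ) (ha : ‖a‖ < 1)
    (hs : ∀ z : ℂ, ‖z‖ < 1 → Summable (fun n => h n * z ^ n)) (n : ℕ) :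
    Filter.Tendsto (fun J => ‖a‖ ^ J * ‖h (n + J)‖ ^ 2) Filter.atTop (nhds 0) := by
  by_cases h0 : a = 0
  · subst h0
    refine tendsto_const_nhds.congr' ?_
    filter_upwards [Filter.eventually_gt_atTop 0] with J hJ
    simp [hJ.ne']
  have hpos : 0 < ‖a‖ := norm_pos_iff.2 h0
  have hsq : ‖((Real.sqrt ‖a‖ : ℝ) : ℂ)‖ = Real.sqrt ‖a‖ := by
    rw [Complex.norm_real, Real.norm_of_nonneg (Real.sqrt_nonneg _)]
  have h1 : Real.sqrt ‖a‖ < 1 := by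
    rw [Real.sqrt_lt' one_pos]; simpa using ha
  have h2 := (hs ((Real.sqrt ‖a‖ : ℝ) : ℂ) (by rw [hsq]; exact h1)).tendsto_atTop_zero
  have h3 := (h2.norm.pow 2).comp (Filter.tendsto_add_atTop_nat n)
  have h4 := h3.mul_const (‖a‖ ^ n)⁻¹
  simp only [norm_zero, ne_eq, OfNat.ofNat_ne_zero, not_false_eq_true, zero_pow, zero_mul] at h4
  refine h4.congr ?_
  intro J
  simp only [Function.comp_apply, norm_mul, norm_pow, hsq]
  rw [mul_pow, ← pow_mul, mul_comm (J + n) 2, pow_mul, Real.sq_sqrt hpos.le, add_comm J n, pow_add]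
  field_simp

theorem summable_h (γ : ℕ → ℝ) (hmono : Monotone γ) (h0 : γ 0 = 0) (h f : ℕ → ℂ) (a : ℂ)
    (ha : ‖a‖ < 1) (hf : ∀ n, h n = f (n + 1) + a * h (n + 1))
    (hs : ∀ z : ℂ, ‖z‖ < 1 → Summable (fun n => h n * z ^ n))
    (hX : Summable fun n => γ n * ‖f n‖ ^ 2) :
    Summable fun n => γ n * ‖h n‖ ^ 2 := by
  have hγ : ∀ n, 0 ≤ γ n := fun n => h0 ▸ hmono (Nat.zero_le n)
  have hr : 0 < 1 - ‖a‖ := by linarith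
  set B := ∑' n, γ n * ‖f n‖ ^ 2 with hB
  have hB0 : 0 ≤ B := tsum_nonneg fun n => mul_nonneg (hγ n) (by positivity)
  refine summable_of_sum_range_le (c := B / (1 - ‖a‖) / (1 - ‖a‖))
    (fun n => mul_nonneg (hγ n) (by positivity)) ?_
  intro N
  have hb : ∀ J, ∑ n ∈ range N, γ n * ‖h n‖ ^ 2 ≤ B / (1 - ‖a‖) / (1 - ‖a‖)
      + ∑ n ∈ range N, γ n * (‖a‖ ^ J * ‖h (n + J)‖ ^ 2) := by
    intro J
    have s1 : ∑ n ∈ range N, γ n * ‖h n‖ ^ 2 ≤ ∑ n ∈ range N,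
        ((∑ j ∈ range J, ‖a‖ ^ j * (γ (n + 1 + j) * ‖f (n + 1 + j)‖ ^ 2)) / (1 - ‖a‖)
        + γ n * (‖a‖ ^ J * ‖h (n + J)‖ ^ 2)) := by
      refine Finset.sum_le_sum fun n _ => ?_
      refine (mul_le_mul_of_nonneg_left (iter_step h f a ha hf n J) (hγ n)).trans ?_
      rw [mul_add, mul_div_assoc', Finset.mul_sum]
      have s0 : ∑ j ∈ range J, γ n * (‖a‖ ^ j * ‖f (n + 1 + j)‖ ^ 2)
          ≤ ∑ j ∈ range J, ‖a‖ ^ j * (γ (n + 1 + j) * ‖f (n + 1 + j)‖ ^ 2) := by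
        refine Finset.sum_le_sum fun j _ => ?_
        rw [mul_left_comm]
        gcongr
        exact hmono (by omega)
      gcongr
    refine s1.trans ?_
    rw [Finset.sum_add_distrib, ← Finset.sum_div, Finset.sum_comm]
    gcongr
    have s2 : ∀ j ∈ range J, ∑ n ∈ range N, ‖a‖ ^ j * (γ (n + 1 + j) * ‖f (n + 1 + j)‖ ^ 2)
        ≤ ‖a‖ ^ j * B := by
      intro j _
      rw [← Finset.mul_sum]
      gcongr
      have : ∑ n ∈ range N, γ (n + 1 + j) * ‖f (n + 1 + j)‖ ^ 2
          = ∑ k ∈ (range N).map (addRightEmbedding (1 + j)), γ k * ‖f k‖ ^ 2 := by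
        simp [Finset.sum_map, add_assoc]
      rw [this]
      exact hX.sum_le_tsum _ fun k _ => mul_nonneg (hγ k) (by positivity)
    refine (Finset.sum_le_sum s2).trans ?_
    rw [← Finset.sum_mul, mul_comm, div_eq_mul_inv]
    gcongr
    rw [← tsum_geometric_of_lt_one (norm_nonneg a) ha]
    exact (summable_geometric_of_lt_one (norm_nonneg a) ha).sum_le_tsum _
      fun k _ => by positivity
  have ht : Filter.Tendsto (fun J => B / (1 - ‖a‖) / (1 - ‖a‖)
      + ∑ n ∈ range N, γ n * (‖a‖ ^ J * ‖h (n + J)‖ ^ 2)) Filter.atTop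
      (nhds (B / (1 - ‖a‖) / (1 - ‖a‖) + ∑ n ∈ range N, γ n * 0)) :=
    tendsto_const_nhds.add
      (tendsto_finsetSum _ fun n _ => (tail_zero h a ha hs n).const_mul _)
  simp only [mul_zero, Finset.sum_const_zero, add_zero] at ht
  exact ge_of_tendsto' ht hb

theorem norm_id (x y a : ℂ) :
    ‖x + -(starRingEnd ℂ) a * y‖ ^ 2 = ‖-a * x + y‖ ^ 2 - (1 - ‖a‖ ^ 2) * (‖y‖ ^ 2 - ‖x‖ ^ 2) := by
  simp only [Complex.sq_norm, Complex.normSq_apply]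
  simp
  ring

theorem one_step (γ : ℕ → ℝ) (hmono : Monotone γ) (h0 : γ 0 = 0) (a : ℂ) (ha : ‖a‖ < 1)
    (P : ℂ → ℂ) (f g h : ℕ → ℂ)
    (hg : ∀ z : ℂ, ‖z‖ < 1 → HasSum (fun n => g n * z ^ n) (P z))
    (hf : ∀ z : ℂ, ‖z‖ < 1 → HasSum (fun n => f n * z ^ n)
      ((z - a) / (1 - (starRingEnd ℂ) a * z) * P z))
    (hh : ∀ z : ℂ, ‖z‖ < 1 → HasSum (fun n => h n * z ^ n) (P z / (1 - (starRingEnd ℂ) a * z)))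
    (hX : Summable fun n => γ n * ‖f n‖ ^ 2) :
    (Summable fun n => γ n * ‖g n‖ ^ 2) ∧
    (Summable fun i => (γ (i + 1) - γ i) * ‖h i‖ ^ 2) ∧
    xnorm2 γ g = xnorm2 γ f - (1 - ‖a‖ ^ 2) * ynorm2 γ h := by
  have hγ : ∀ n, 0 ≤ γ n := fun n => h0 ▸ hmono (Nat.zero_le n)
  have hne : ∀ z : ℂ, ‖z‖ < 1 → 1 - (starRingEnd ℂ) a * z ≠ 0 := by
    intro z hz h
    have h1 : (starRingEnd ℂ) a * z = 1 := (sub_eq_zero.1 h).symm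
    have h2 : ‖a‖ * ‖z‖ = 1 := by
      have := congrArg norm h1
      simpa using this
    nlinarith [norm_nonneg a, norm_nonneg z]
  have hgc : g = fun n => 1 * h n + -(starRingEnd ℂ) a * (if n = 0 then 0 else h (n - 1)) := by
    refine coef_unique _ _ P hg fun z hz => ?_
    have := shift_hasSum h 1 (-(starRingEnd ℂ) a) z _ (hh z hz)
    convert this using 1
    have := hne z hz
    rw [neg_mul, ← sub_eq_add_neg]
    field_simp
  have hfc : f = fun n => -a * h n + 1 * (if n = 0 then 0 else h (n - 1)) := by
    refine coef_unique _ _ _ hf fun z hz => ?_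
    have := shift_hasSum h (-a) 1 z _ (hh z hz)
    convert this using 1
    ring
  have hrec : ∀ n, h n = f (n + 1) + a * h (n + 1) := by
    intro n
    rw [hfc]; simp
  have hS := summable_h γ hmono h0 h f a ha hrec (fun z hz => (hh z hz).summable) hX
  have hX1 := (summable_nat_add_iff 1).2 hX
  have hS1 := (summable_nat_add_iff 1).2 hS
  have hT : Summable fun n => γ (n + 1) * ‖h n‖ ^ 2 := by
    refine Summable.of_nonneg_of_le (fun n => mul_nonneg (hγ _) (by positivity)) (fun n => ?_)
      ((hX1.mul_right (1 / (1 - ‖a‖))).add (hS1.mul_right ‖a‖))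
    have := conv_step (f (n + 1)) (h (n + 1)) a ha
    rw [← hrec n] at this
    refine (mul_le_mul_of_nonneg_left this (hγ (n + 1))).trans (le_of_eq ?_)
    ring
  have hgid : ∀ n, γ (n + 1) * ‖g (n + 1)‖ ^ 2 = γ (n + 1) * ‖f (n + 1)‖ ^ 2
      - (1 - ‖a‖ ^ 2) * (γ (n + 1) * ‖h n‖ ^ 2 - γ (n + 1) * ‖h (n + 1)‖ ^ 2) := by
    intro n
    have := norm_id (h (n + 1)) (h n) a
    rw [hgc, hfc]
    simp only [Nat.add_eq_zero_iff, one_ne_zero, and_false, if_false, Nat.add_sub_cancel, one_mul]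
    rw [this]; ring
  have hG1 : HasSum (fun n => γ (n + 1) * ‖g (n + 1)‖ ^ 2)
      (∑' n, γ (n + 1) * ‖f (n + 1)‖ ^ 2 - (1 - ‖a‖ ^ 2) *
        (∑' n, γ (n + 1) * ‖h n‖ ^ 2 - ∑' n, γ (n + 1) * ‖h (n + 1)‖ ^ 2)) := by
    rw [funext hgid]
    exact hX1.hasSum.sub ((hT.hasSum.sub hS1.hasSum).mul_left (1 - ‖a‖ ^ 2))
  have hGS : Summable fun n => γ n * ‖g n‖ ^ 2 := (summable_nat_add_iff 1).1 hG1.summable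
  have hY : HasSum (fun i => (γ (i + 1) - γ i) * ‖h i‖ ^ 2)
      (∑' n, γ (n + 1) * ‖h n‖ ^ 2 - ∑' n, γ n * ‖h n‖ ^ 2) := by
    simp_rw [sub_mul]
    exact hT.hasSum.sub hS.hasSum
  refine ⟨hGS, hY.summable, ?_⟩
  unfold xnorm2 ynorm2
  rw [hY.tsum_eq, hGS.tsum_eq_zero_add, hG1.tsum_eq, hX.tsum_eq_zero_add, hS.tsum_eq_zero_add, h0]
  ring

/-- Main identity for finitely many reflections: with the partial decompositions
`F_k(z) = (∏_{j=k+1}^m (z-α_j)/(1-ᾱ_j z))·G(z)` and `H_{α_k} = F_k/(1-ᾱ_k z)`, for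
`1 ≤ n ≤ m`, `‖F_n‖_{X_γ}² = ‖F‖_{X_γ}² − Σ_{j=1}^n (1-|α_j|²)‖H_{α_j}‖_{Y_γ}²`. -/
theorem stmt3 (γ : ℕ → ℝ) (hmono : Monotone γ) (h0 : γ 0 = 0)
    (m : ℕ) (α : ℕ → ℂ) (hα : ∀ j ∈ Icc 1 m, ‖α j‖ < 1)
    (G : ℂ → ℂ) (hG0 : ∀ z : ℂ, ‖z‖ < 1 → G z ≠ 0)
    (Fcoef : ℕ → ℕ → ℂ) (Hcoef : ℕ → ℕ → ℂ)
    -- `Fcoef k` are the Taylor coefficients of the partial decomposition `F_k`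
    (hFcoef : ∀ k ≤ m, ∀ z : ℂ, ‖z‖ < 1 →
      HasSum (fun n => Fcoef k n * z ^ n)
        ((∏ j ∈ Icc (k + 1) m, (z - α j) / (1 - (starRingEnd ℂ) (α j) * z)) * G z))
    -- `Hcoef k` are the Taylor coefficients of `H_{α_k} = F_k/(1-ᾱ_k z)`
    (hHcoef : ∀ k ∈ Icc 1 m, ∀ z : ℂ, ‖z‖ < 1 →
      HasSum (fun n => Hcoef k n * z ^ n)
        (((∏ j ∈ Icc (k + 1) m, (z - α j) / (1 - (starRingEnd ℂ) (α j) * z)) * G z) /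
          (1 - (starRingEnd ℂ) (α k) * z)))
    -- `F = F_0 ∈ H²` and `F ∈ X_γ`
    (hH2 : Summable fun n => ‖Fcoef 0 n‖ ^ 2)
    (hX : Summable fun n => γ n * ‖Fcoef 0 n‖ ^ 2) :
    ∀ n, 1 ≤ n → n ≤ m →
      (∀ j ∈ Icc 1 n, Summable fun i => (γ (i + 1) - γ i) * ‖Hcoef j i‖ ^ 2) ∧
      xnorm2 γ (Fcoef n) =
        xnorm2 γ (Fcoef 0) -
          ∑ j ∈ Icc 1 n, (1 - ‖α j‖ ^ 2) * ynorm2 γ (Hcoef j) := by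
  have step : ∀ k, k + 1 ≤ m → (Summable fun n => γ n * ‖Fcoef k n‖ ^ 2) →
      (Summable fun n => γ n * ‖Fcoef (k + 1) n‖ ^ 2) ∧
      (Summable fun i => (γ (i + 1) - γ i) * ‖Hcoef (k + 1) i‖ ^ 2) ∧
      xnorm2 γ (Fcoef (k + 1)) = xnorm2 γ (Fcoef k)
        - (1 - ‖α (k + 1)‖ ^ 2) * ynorm2 γ (Hcoef (k + 1)) := by
    intro k hk hS
    have hmem : k + 1 ∈ Icc 1 m := by simp; omega
    refine one_step γ hmono h0 (α (k + 1)) (hα _ hmem) _ _ _ _ (hFcoef (k + 1) hk) ?_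
      (hHcoef (k + 1) hmem) hS
    intro z hz
    have := hFcoef k (by omega) z hz
    rw [← Finset.insert_Icc_add_one_left_eq_Icc hk, Finset.prod_insert (by simp), mul_assoc] at this
    exact this
  have main : ∀ n, n ≤ m → (Summable fun i => γ i * ‖Fcoef n i‖ ^ 2) ∧
      (∀ j ∈ Icc 1 n, Summable fun i => (γ (i + 1) - γ i) * ‖Hcoef j i‖ ^ 2) ∧
      xnorm2 γ (Fcoef n) =
        xnorm2 γ (Fcoef 0) -
          ∑ j ∈ Icc 1 n, (1 - ‖α j‖ ^ 2) * ynorm2 γ (Hcoef j) := by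
    intro n
    induction n with
    | zero => intro _; exact ⟨hX, by simp, by simp⟩
    | succ k ih =>
      intro hk
      obtain ⟨i1, i2, i3⟩ := ih (by omega)
      obtain ⟨s1, s2, s3⟩ := step k hk i1
      refine ⟨s1, ?_, ?_⟩
      · intro j hj
        rw [Finset.mem_Icc] at hj
        rcases Nat.lt_or_ge j (k + 1) with hlt | hge
        · exact i2 j (by rw [Finset.mem_Icc]; omega)
        · have : j = k + 1 := by omega
          subst this; exact s2
      · rw [Finset.sum_Icc_succ_top (by omega), s3, i3]; ring
  intro n _ hn
  exact (main n hn).2
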